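/- Let σ : Σ → Σ be a transitive subshift of finite type, φ : Σ → ℚ a locally constant constraint, and A : Σ → ℝ a Walters potential. For every rational number r in the interior of the rotation set φ_*(M_σ), one has β_{A,φ}(r) = sup{∫A dμ : μ ∈ φ_*^{-1}(r), μ a periodic probability measure}. -/

import Mathlib

open MeasureTheory Filter Topology Set

/-- The left shift on the full shift space `{1,…,N}^ℕ`. -/
def Shift {N : ℕ} : (ℕ → Fin N) → (ℕ → Fin N) := fun x i => x (i + 1)

/-- `S` is a subshift of finite type: it is the set of sequences all of whose transitions
are allowed by some transition relation `M`. -/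
def IsSubshiftFT {N : ℕ} (S : Set (ℕ → Fin N)) : Prop :=
  ∃ M : Fin N → Fin N → Prop, S = {x | ∀ i, M (x i) (x (i + 1))}

/-- The Birkhoff sum `S_k f` for the shift. -/
def birkhoff {N : ℕ} {E : Type*} [AddCommMonoid E] (k : ℕ) (f : (ℕ → Fin N) → E)
    (x : ℕ → Fin N) : E :=
  ∑ j ∈ Finset.range k, f (Shift^[j] x)

open Classical in
/-- The metric `d(x,y) = λ^{min{j : x_j ≠ y_j}}` on the shift space. -/
noncomputable def sdist {N : ℕ} (lam : ℝ) (x y : ℕ → Fin N) : ℝ :=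
  if x = y then 0 else lam ^ sInf {j | x j ≠ y j}

/-- `f` is a Walters function on `S` (for the metric with parameter `λ`): there is
`H : ℝ₊ → ℝ₊ ∪ {+∞}` increasing, null and continuous at zero, such that `d_k(x,y) ≤ s`
implies `|S_k f(x) - S_k f(y)| ≤ H(s)`. -/
def IsWalters {N : ℕ} (S : Set (ℕ → Fin N)) (lam : ℝ) (f : (ℕ → Fin N) → ℝ) : Prop :=
  ∃ H : ℝ → ENNReal, Monotone H ∧ H 0 = 0 ∧ Tendsto H (nhdsWithin 0 (Ioi 0)) (nhds 0) ∧
    ∀ s : ℝ, 0 ≤ s → ∀ k : ℕ, 0 < k → ∀ x ∈ S, ∀ y ∈ S,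
      (∀ j < k, sdist lam (Shift^[j] x) (Shift^[j] y) ≤ s) →
      ENNReal.ofReal |birkhoff k f x - birkhoff k f y| ≤ H s

/-- A function on the shift space is locally constant if it depends on finitely many
coordinates. -/
def LocallyConstantFn {N : ℕ} {E : Type*} (f : (ℕ → Fin N) → E) : Prop :=
  ∃ j : ℕ, ∀ x y : ℕ → Fin N, (∀ i ≤ j, x i = y i) → f x = f y

/-- The set `M_σ` of shift-invariant Borel probability measures giving full mass to the
subshift `S`. -/
def MS {N : ℕ} (S : Set (ℕ → Fin N)) : Set (ProbabilityMeasure (ℕ → Fin N)) :=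
  {μ | (μ : Measure (ℕ → Fin N)).map Shift = (μ : Measure (ℕ → Fin N)) ∧
    (μ : Measure (ℕ → Fin N)) S = 1}

/-- `μ` is a periodic probability measure of the subshift `S`: the uniform probability
measure on the orbit of a periodic point of `S`. -/
def IsPeriodicMeasure {N : ℕ} (S : Set (ℕ → Fin N)) (μ : ProbabilityMeasure (ℕ → Fin N)) :
    Prop :=
  ∃ z ∈ S, ∃ M : ℕ, 0 < M ∧ Shift^[M] z = z ∧
    (μ : Measure (ℕ → Fin N)) =
      (M : ENNReal)⁻¹ • ∑ j ∈ Finset.range M, Measure.dirac (Shift^[j] z)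

/-- `f` is joint recurrent with respect to the measure `ν`: for every measurable `D`,
`ν(Ξ(D)) = ν(D)`, where `Ξ(D)` is the set of `z ∈ D` such that for every `ε > 0` there is
`L > 0` with `σ^L(z) ∈ D` and `‖S_L f(z) - L f_*(ν)‖ < ε`. -/
def JointRec {N n : ℕ} (f : (ℕ → Fin N) → EuclideanSpace ℝ (Fin n))
    (ν : Measure (ℕ → Fin N)) : Prop :=
  ∀ D : Set (ℕ → Fin N), MeasurableSet D →
    ν {z ∈ D | ∀ ε > 0, ∃ L : ℕ, 0 < L ∧ Shift^[L] z ∈ D ∧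
      ‖birkhoff L f z - (L : ℝ) • ∫ x, f x ∂ν‖ < ε} = ν D

/-- Topological transitivity of the subshift `S`, expressed on cylinder sets: any two finite
words of `S` can be connected inside `S` by iterating the shift. -/
def TransitiveSubshift {N : ℕ} (S : Set (ℕ → Fin N)) : Prop :=
  ∀ x ∈ S, ∀ y ∈ S, ∀ m : ℕ, ∃ z ∈ S, ∃ k : ℕ,
    (∀ i < m, z i = x i) ∧ (∀ i < m, Shift^[k] z i = y i)

/-- The rotation set of a real constraint `φ` on the subshift `S`. -/
noncomputable def rotSet1 {N : ℕ} (S : Set (ℕ → Fin N)) (φ : (ℕ → Fin N) → ℝ) : Set ℝ :=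
  {h : ℝ | ∃ μ ∈ MS S, ∫ x, φ x ∂(μ : Measure (ℕ → Fin N)) = h}

/-- The beta function of the subshift `S` for a real constraint:
`β_{A,φ}(r) = sup {∫A dμ : μ ∈ M_σ, φ_*(μ) = r}`. -/
noncomputable def betaS1 {N : ℕ} (S : Set (ℕ → Fin N)) (A φ : (ℕ → Fin N) → ℝ)
    (r : ℝ) : ℝ :=
  sSup {t : ℝ | ∃ μ ∈ MS S, ∫ x, φ x ∂(μ : Measure (ℕ → Fin N)) = r ∧
    ∫ x, A x ∂(μ : Measure (ℕ → Fin N)) = t}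

/-- Walks in the directed graph `E` on `V`, recording the length together with the sums of an
integer weight `F` and of a real weight `G` over all visited vertices but the last one. -/
inductive WeightedWalk {V : Type*} (E : V → V → Prop) (F : V → ℤ) (G : V → ℝ) :
    V → V → ℕ → ℤ → ℝ → Prop
  | nil (v : V) : WeightedWalk E F G v v 0 0 0
  | cons {u v w : V} {n : ℕ} {a : ℤ} {t : ℝ} (h : E u v) (p : WeightedWalk E F G v w n a t) :
      WeightedWalk E F G u w (n + 1) (F u + a) (G u + t)

namespace WeightedWalk

variable {V : Type*} {E : V → V → Prop} {F : V → ℤ} {G : V → ℝ}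

theorem append {u v w : V} {n m : ℕ} {a b : ℤ} {s t : ℝ} (p : WeightedWalk E F G u v n a s)
    (q : WeightedWalk E F G v w m b t) : WeightedWalk E F G u w (n + m) (a + b) (s + t) := by
  induction p with
  | nil v => simpa using q
  | cons h _ ih =>
    have := cons h (ih q)
    convert this using 1 <;> ring

theorem pow {v : V} {n : ℕ} {a : ℤ} {t : ℝ} (p : WeightedWalk E F G v v n a t) (k : ℕ) :
    WeightedWalk E F G v v (k * n) (k * a) (k * t) := by
  induction k with
  | zero => simpa using nil v
  | succ k ih =>
    convert ih.append p using 1 <;> push_cast <;> ring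

theorem exists_path {u w : V} {n : ℕ} {a : ℤ} {t : ℝ} (p : WeightedWalk E F G u w n a t) :
    ∃ x : ℕ → V, x 0 = u ∧ x n = w ∧ (∀ i < n, E (x i) (x (i + 1))) ∧
      ∑ i ∈ Finset.range n, F (x i) = a ∧ ∑ i ∈ Finset.range n, G (x i) = t := by
  induction p with
  | nil v => exact ⟨fun _ => v, by simp⟩
  | @cons u v w n a t h _ ih =>
    obtain ⟨x, h0, hn, hE, hF, hG⟩ := ih
    refine ⟨fun i => Nat.casesOn i u x, rfl, hn, ?_, ?_, ?_⟩
    · rintro (_ | i) hi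
      · simpa [h0] using h
      · exact hE i (by omega)
    · rw [Finset.sum_range_succ', ← hF]
      exact add_comm _ _
    · rw [Finset.sum_range_succ', ← hG]
      exact add_comm _ _

theorem of_path (x : ℕ → V) (hE : ∀ i, E (x i) (x (i + 1))) (n : ℕ) :
    WeightedWalk E F G (x 0) (x n) n (∑ i ∈ Finset.range n, F (x i))
      (∑ i ∈ Finset.range n, G (x i)) := by
  induction n with
  | zero => simpa using nil (x 0)
  | succ n ih =>
    rw [Finset.sum_range_succ, Finset.sum_range_succ]
    simpa using ih.append (cons (hE n) (nil _))

theorem eq_zero_of_length_eq_zero {u w : V} {a : ℤ} {t : ℝ}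
    (p : WeightedWalk E F G u w 0 a t) : a = 0 ∧ t = 0 := by
  obtain ⟨x, -, -, -, h1, h2⟩ := p.exists_path
  simp at h1 h2
  exact ⟨h1.symm, h2.symm⟩

/-- If every closed walk has nonpositive weight in a finite strongly connected graph, then the
weights of all walks are bounded above. -/
theorem exists_bound [Finite V] (hconn : ∀ u v, ∃ n a t, WeightedWalk E F G u v n a t) (α β : ℝ)
    (hclosed : ∀ v n a t, WeightedWalk E F G v v n a t → α * a + β * t ≤ 0) :
    ∃ K : ℝ, ∀ u v n a t, WeightedWalk E F G u v n a t → α * a + β * t ≤ K := by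
  choose l b s hW using hconn
  obtain ⟨K, hK⟩ := (Set.finite_range
    (fun q : V × V => -(α * (b q.1 q.2 : ℝ) + β * s q.1 q.2))).bddAbove
  refine ⟨K, fun u v n a t p => ?_⟩
  have h1 := hclosed _ _ _ _ (p.append (hW v u))
  have h2 := hK ⟨(v, u), rfl⟩
  push_cast at h1
  simp only at h2
  linarith

/-- Gluing a closed walk of positive weight with a closed walk of negative weight. -/
theorem mul_add_mul_nonpos (hconn : ∀ u v, ∃ n a t, WeightedWalk E F G u v n a t)
    (hzero : ∀ v n t, WeightedWalk E F G v v n 0 t → t ≤ 0)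
    {v w : V} {n m : ℕ} {a b : ℤ} {s t : ℝ} (ha : 0 < a) (hb : b < 0)
    (p : WeightedWalk E F G v v n a s) (q : WeightedWalk E F G w w m b t) :
    -b * s + a * t ≤ 0 := by
  obtain ⟨n₁, a₁, t₁, p₁⟩ := hconn v w
  obtain ⟨n₂, a₂, t₂, p₂⟩ := hconn w v
  by_contra! hpos
  obtain ⟨C, hC⟩ : ∃ C : ℝ, C = a * (t₁ + t₂) - (a₁ + a₂) * s := ⟨_, rfl⟩
  obtain ⟨k, hk⟩ := exists_nat_gt (-C / (-b * s + a * t))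
  rw [div_lt_iff₀ hpos] at hk
  obtain ⟨k', hk1, hk2⟩ : ∃ k' : ℕ, k ≤ k' ∧ a₁ + a₂ ≤ k' :=
    ⟨max k (a₁ + a₂).toNat, le_max_left _ _, by
      have := Int.self_le_toNat (a₁ + a₂)
      have h2 : (a₁ + a₂).toNat ≤ max k (a₁ + a₂).toNat := le_max_right _ _
      omega⟩
  obtain ⟨i, hi⟩ : ∃ i : ℕ, (i : ℤ) = -(a₁ + a₂ + k' * b) :=
    ⟨(-(a₁ + a₂ + k' * b)).toNat, Int.toNat_of_nonneg (by nlinarith)⟩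
  obtain ⟨j, hj⟩ : ∃ j : ℕ, (j : ℤ) = a := ⟨a.toNat, Int.toNat_of_nonneg ha.le⟩
  have W := (((p₁.append (q.pow k')).append p₂).pow j).append (p.pow i)
  have e : (j : ℤ) * (a₁ + k' * b + a₂) + i * a = 0 := by rw [hi, hj]; ring
  rw [e] at W
  have h := hzero _ _ _ W
  have hi' : (i : ℝ) = -(a₁ + a₂ + k' * b) := by exact_mod_cast hi
  have hj' : (j : ℝ) = a := by exact_mod_cast hj
  rw [hi', hj'] at h
  have hk1' : (k : ℝ) ≤ k' := by exact_mod_cast hk1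
  nlinarith [mul_le_mul_of_nonneg_right hk1' hpos.le]

/-- Existence of a Lagrange multiplier. -/
theorem exists_multiplier (hconn : ∀ u v, ∃ n a t, WeightedWalk E F G u v n a t)
    (hzero : ∀ v n t, WeightedWalk E F G v v n 0 t → t ≤ 0)
    (hpos : ∃ v n a t, 0 < a ∧ WeightedWalk E F G v v n a t)
    (hneg : ∃ v n a t, a < 0 ∧ WeightedWalk E F G v v n a t) :
    ∃ c : ℝ, ∀ v n a t, WeightedWalk E F G v v n a t → t ≤ c * a := by
  have key : ∀ v n a s w m b t, 0 < a → b < 0 → WeightedWalk E F G v v n a s →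
      WeightedWalk E F G w w m b t → s / a ≤ t / b := by
    intro v n a s w m b t ha hb p q
    have h := mul_add_mul_nonpos hconn hzero ha hb p q
    have ha' : (0 : ℝ) < a := by exact_mod_cast ha
    have hb' : (b : ℝ) < 0 := by exact_mod_cast hb
    rw [div_le_iff₀ ha', div_mul_eq_mul_div, le_div_iff_of_neg hb']
    linarith
  set U : Set ℝ := {y | ∃ v n a s, 0 < a ∧ WeightedWalk E F G v v n a s ∧ s / (a : ℝ) = y}
  have hUne : U.Nonempty := by
    obtain ⟨v, n, a, s, ha, p⟩ := hpos
    exact ⟨_, v, n, a, s, ha, p, rfl⟩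
  have hUb : ∀ w m b t, b < 0 → WeightedWalk E F G w w m b t → t / (b : ℝ) ∈ upperBounds U := by
    rintro w m b t hb q _ ⟨v, n, a, s, ha, p, rfl⟩
    exact key _ _ _ _ _ _ _ _ ha hb p q
  have hUbdd : BddAbove U := by
    obtain ⟨w, m, b, t, hb, q⟩ := hneg
    exact ⟨_, hUb _ _ _ _ hb q⟩
  refine ⟨sSup U, fun v n a t p => ?_⟩
  rcases lt_trichotomy a 0 with ha | rfl | ha
  · have h := csSup_le hUne (hUb _ _ _ _ ha p)
    rwa [le_div_iff_of_neg (by exact_mod_cast ha)] at h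
  · simpa using hzero _ _ _ p
  · have h := le_csSup hUbdd ⟨v, n, a, t, ha, p, rfl⟩
    rwa [div_le_iff₀ (by exact_mod_cast ha)] at h

end WeightedWalk

section Dynamics

variable {N : ℕ}

theorem shift_iterate_apply (k i : ℕ) (x : ℕ → Fin N) : Shift^[k] x i = x (i + k) := by
  induction k generalizing x with
  | zero => rfl
  | succ k ih => rw [Function.iterate_succ_apply, ih, Shift]; congr 1

theorem measurable_shift : Measurable (Shift : (ℕ → Fin N) → (ℕ → Fin N)) :=
  measurable_pi_lambda _ fun i => measurable_pi_apply (i + 1)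

theorem IsSubshiftFT.measurableSet {S : Set (ℕ → Fin N)} (hS : IsSubshiftFT S) :
    MeasurableSet S := by
  obtain ⟨M, rfl⟩ := hS
  rw [Set.ofPred_forall]
  refine MeasurableSet.iInter fun i => ?_
  have hm : Measurable fun x : ℕ → Fin N => (x i, x (i + 1)) :=
    (measurable_pi_apply i).prodMk (measurable_pi_apply (i + 1))
  exact hm (Set.toFinite {q : Fin N × Fin N | M q.1 q.2}).measurableSet

theorem IsSubshiftFT.shift_iterate_mem {S : Set (ℕ → Fin N)} (hS : IsSubshiftFT S)
    {x : ℕ → Fin N} (hx : x ∈ S) (k : ℕ) : Shift^[k] x ∈ S := by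
  obtain ⟨M, rfl⟩ := hS
  intro i
  rw [shift_iterate_apply, shift_iterate_apply, Nat.add_right_comm]
  exact hx (i + k)

theorem ae_mem_of_mem_MS {S : Set (ℕ → Fin N)} (hS : IsSubshiftFT S)
    {μ : ProbabilityMeasure (ℕ → Fin N)} (hμ : μ ∈ MS S) :
    ∀ᵐ x ∂(μ : Measure (ℕ → Fin N)), x ∈ S :=
  (mem_ae_iff_prob_eq_one hS.measurableSet).2 hμ.2

/-- A function whose Birkhoff sums are bounded above has nonpositive integral against every
invariant measure. -/
theorem integral_nonpos_of_birkhoff_le {S : Set (ℕ → Fin N)} (hS : IsSubshiftFT S)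
    {μ : ProbabilityMeasure (ℕ → Fin N)} (hμ : μ ∈ MS S) {ψ : (ℕ → Fin N) → ℝ}
    (hψ : Integrable ψ (μ : Measure (ℕ → Fin N))) {K : ℝ}
    (hK : ∀ n, ∀ x ∈ S, birkhoff n ψ x ≤ K) : ∫ x, ψ x ∂(μ : Measure (ℕ → Fin N)) ≤ 0 := by
  have hmp : ∀ j, MeasurePreserving (Shift^[j]) (μ : Measure (ℕ → Fin N)) μ :=
    fun j => (MeasurePreserving.mk measurable_shift hμ.1).iterate j
  have hint : ∀ j, Integrable (fun x => ψ (Shift^[j] x)) (μ : Measure (ℕ → Fin N)) :=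
    fun j => (hmp j).integrable_comp_of_integrable hψ
  have heq : ∀ j, ∫ x, ψ (Shift^[j] x) ∂(μ : Measure (ℕ → Fin N)) =
      ∫ x, ψ x ∂(μ : Measure (ℕ → Fin N)) := by
    intro j
    have h := integral_map (μ := (μ : Measure (ℕ → Fin N))) (hmp j).measurable.aemeasurable
      (f := ψ) (by rw [(hmp j).map_eq]; exact hψ.aestronglyMeasurable)
    rw [(hmp j).map_eq] at h
    exact h.symm
  have hle : ∀ n : ℕ, n * ∫ x, ψ x ∂(μ : Measure (ℕ → Fin N)) ≤ K := by
    intro n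
    have h1 : ∫ x, birkhoff n ψ x ∂(μ : Measure (ℕ → Fin N)) =
        n * ∫ x, ψ x ∂(μ : Measure (ℕ → Fin N)) := by
      simp only [birkhoff]
      rw [integral_finsetSum _ fun j _ => hint j]
      simp [heq]
    have hb : Integrable (fun x => birkhoff n ψ x) (μ : Measure (ℕ → Fin N)) :=
      integrable_finsetSum _ fun j _ => hint j
    rw [← h1]
    have h2 := integral_mono_ae hb (integrable_const K)
      ((ae_mem_of_mem_MS hS hμ).mono fun x hx => hK n x hx)
    simpa using h2
  by_contra! hpos
  obtain ⟨n, hn⟩ := exists_nat_gt (K / ∫ x, ψ x ∂(μ : Measure (ℕ → Fin N)))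
  rw [div_lt_iff₀ hpos] at hn
  exact absurd (hle n) (not_le.2 hn)

/-- A periodic point of the subshift carries a periodic measure, whose integrals are the averages
over the orbit. -/
theorem exists_periodicMeasure {S : Set (ℕ → Fin N)} (hS : IsSubshiftFT S) {z : ℕ → Fin N}
    (hz : z ∈ S) {n : ℕ} (hn : 0 < n) (hper : Shift^[n] z = z) :
    ∃ μ ∈ MS S, IsPeriodicMeasure S μ ∧
      ∀ f : (ℕ → Fin N) → ℝ, ∫ x, f x ∂(μ : Measure (ℕ → Fin N)) = birkhoff n f z / n := by
  set ν : Measure (ℕ → Fin N) :=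
    (n : ENNReal)⁻¹ • ∑ j ∈ Finset.range n, Measure.dirac (Shift^[j] z) with hν
  have hn0 : (n : ENNReal) ≠ 0 := by exact_mod_cast hn.ne'
  have hmass : ∀ B : Set (ℕ → Fin N), MeasurableSet B → (∀ j, Shift^[j] z ∈ B) → ν B = 1 := by
    intro B hB hzB
    simp only [hν, Measure.smul_apply, Measure.coe_finsetSum, Finset.sum_apply,
      Measure.dirac_apply' _ hB, smul_eq_mul]
    simp only [Set.indicator_of_mem (hzB _)]
    simp [ENNReal.inv_mul_cancel hn0 (ENNReal.natCast_ne_top n)]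
  have hprob : IsProbabilityMeasure ν := ⟨hmass _ MeasurableSet.univ fun _ => trivial⟩
  have hinv : ν.map Shift = ν := by
    have h1 : ν.map Shift =
        (n : ENNReal)⁻¹ • ∑ j ∈ Finset.range n, Measure.dirac (Shift^[j + 1] z) := by
      rw [hν, Measure.map_smul, ← Measure.mapₗ_apply_of_measurable measurable_shift, map_sum]
      congr 1
      refine Finset.sum_congr rfl fun j _ => ?_
      rw [Measure.mapₗ_apply_of_measurable measurable_shift,
        Measure.map_dirac' measurable_shift, Function.iterate_succ_apply']
    rw [h1, hν]
    congr 1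
    obtain ⟨k, rfl⟩ : ∃ k, n = k + 1 := ⟨n - 1, by omega⟩
    rw [Finset.sum_range_succ, hper, Finset.sum_range_succ']
    rfl
  refine ⟨⟨ν, hprob⟩, ⟨hinv, hmass S hS.measurableSet fun j => hS.shift_iterate_mem hz j⟩,
    ⟨z, hz, n, hn, hper, rfl⟩, fun f => ?_⟩
  change ∫ x, f x ∂ν = _
  rw [hν, integral_smul_measure, integral_finsetSum_measure fun j _ => integrable_dirac (by simp)]
  simp [birkhoff, div_eq_inv_mul]

/-- The initial word of length `m` of a sequence. -/
def initialWord (m : ℕ) (x : ℕ → Fin N) : Fin m → Fin N := fun i => x i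

/-- The words of length `m` occurring in the subshift `S`. -/
abbrev Words (S : Set (ℕ → Fin N)) (m : ℕ) : Type :=
  {v : Fin m → Fin N // ∃ x ∈ S, initialWord m x = v}

/-- The transitions between words of length `m` of the subshift `S`. -/
def WordStep (S : Set (ℕ → Fin N)) (m : ℕ) (u v : Words S m) : Prop :=
  ∃ x ∈ S, initialWord m x = u.1 ∧ initialWord m (Shift x) = v.1

variable {S : Set (ℕ → Fin N)} {m : ℕ} {F : Words S m → ℤ} {G : Words S m → ℝ}
  {f g : (ℕ → Fin N) → ℝ}

/-- The initial word of `σ^i x`. -/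
def orbitWord (hS : IsSubshiftFT S) (m : ℕ) {x : ℕ → Fin N} (hx : x ∈ S) (i : ℕ) : Words S m :=
  ⟨initialWord m (Shift^[i] x), _, hS.shift_iterate_mem hx i, rfl⟩

theorem wordStep_orbitWord (hS : IsSubshiftFT S) {x : ℕ → Fin N} (hx : x ∈ S) (i : ℕ) :
    WordStep S m (orbitWord hS m hx i) (orbitWord hS m hx (i + 1)) :=
  ⟨_, hS.shift_iterate_mem hx i, rfl,
    congrArg (initialWord m) (Function.iterate_succ_apply' Shift i x).symm⟩

theorem exists_walk_of_mem (hS : IsSubshiftFT S) {x : ℕ → Fin N} (hx : x ∈ S) (n : ℕ)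
    (hf : ∀ x (hx : x ∈ S), f x = F ⟨initialWord m x, x, hx, rfl⟩)
    (hg : ∀ x (hx : x ∈ S), g x = G ⟨initialWord m x, x, hx, rfl⟩) :
    ∃ a : ℤ, (a : ℝ) = birkhoff n f x ∧ WeightedWalk (WordStep S m) F G
      (orbitWord hS m hx 0) (orbitWord hS m hx n) n a (birkhoff n g x) := by
  refine ⟨∑ i ∈ Finset.range n, F (orbitWord hS m hx i), ?_, ?_⟩
  · push_cast
    exact (Finset.sum_congr rfl fun i _ => hf _ (hS.shift_iterate_mem hx i)).symm
  · have e : birkhoff n g x = ∑ i ∈ Finset.range n, G (orbitWord hS m hx i) :=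
      Finset.sum_congr rfl fun i _ => hg _ (hS.shift_iterate_mem hx i)
    rw [e]
    exact WeightedWalk.of_path _ (wordStep_orbitWord hS hx) n

theorem TransitiveSubshift.exists_walk (hS : IsSubshiftFT S) (htrans : TransitiveSubshift S)
    (u v : Words S m) : ∃ n a t, WeightedWalk (WordStep S m) F G u v n a t := by
  obtain ⟨u, x, hx, rfl⟩ := u
  obtain ⟨v, y, hy, rfl⟩ := v
  obtain ⟨z, hz, k, h1, h2⟩ := htrans x hx y hy m
  have W := WeightedWalk.of_path (F := F) (G := G) _ (wordStep_orbitWord (m := m) hS hz) k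
  have e1 : orbitWord hS m hz 0 = ⟨initialWord m x, x, hx, rfl⟩ :=
    Subtype.ext (funext fun i => h1 i i.2)
  have e2 : orbitWord hS m hz k = ⟨initialWord m y, y, hy, rfl⟩ :=
    Subtype.ext (funext fun i => h2 i i.2)
  rw [e1, e2] at W
  exact ⟨_, _, _, W⟩

/-- A closed walk of words is realised by a periodic point of the subshift. -/
theorem WeightedWalk.exists_periodic (hS : IsSubshiftFT S) (hm : 0 < m)
    (hf : ∀ x (hx : x ∈ S), f x = F ⟨initialWord m x, x, hx, rfl⟩)
    (hg : ∀ x (hx : x ∈ S), g x = G ⟨initialWord m x, x, hx, rfl⟩)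
    {v : Words S m} {n : ℕ} (hn : 0 < n) {a : ℤ} {t : ℝ}
    (p : WeightedWalk (WordStep S m) F G v v n a t) :
    ∃ z ∈ S, Shift^[n] z = z ∧ birkhoff n f z = a ∧ birkhoff n g z = t := by
  obtain ⟨x, h0, hxn, hE, hF, hG⟩ := p.exists_path
  set y : ℕ → Words S m := fun i => x (i % n) with hy
  have hEy : ∀ i, WordStep S m (y i) (y (i + 1)) := by
    intro i
    have hi := Nat.mod_lt i hn
    have h := hE (i % n) hi
    have e : x ((i + 1) % n) = x (i % n + 1) := by
      rcases Nat.lt_or_ge (i % n + 1) n with hlt | hge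
      · rw [← Nat.mod_add_mod, Nat.mod_eq_of_lt hlt]
      · have : i % n + 1 = n := by omega
        rw [← Nat.mod_add_mod, this, Nat.mod_self, h0, hxn]
    simp only [hy, e]
    exact h
  set z : ℕ → Fin N := fun i => (y i).1 ⟨0, hm⟩ with hz
  have hyz : ∀ (j : ℕ) (hj : j < m) (i : ℕ), (y i).1 ⟨j, hj⟩ = z (i + j) := by
    intro j
    induction j with
    | zero => intro _ i; rfl
    | succ j ih =>
      intro hj i
      obtain ⟨w, -, hw1, hw2⟩ := hEy i
      have h := ih (by omega) (i + 1)
      rw [← hw2] at h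
      rw [← hw1, ← add_assoc, Nat.add_right_comm, ← h]
      rfl
  have hzS : z ∈ S := by
    have hstep : ∀ i, ∃ w ∈ S, w 0 = z i ∧ w 1 = z (i + 1) := by
      intro i
      obtain ⟨w, hwS, hw1, hw2⟩ := hEy i
      exact ⟨w, hwS, congrFun hw1 ⟨0, hm⟩, congrFun hw2 ⟨0, hm⟩⟩
    obtain ⟨M, rfl⟩ := hS
    intro i
    obtain ⟨w, hwS, hw1, hw2⟩ := hstep i
    rw [← hw1, ← hw2]
    exact hwS 0
  have hword : ∀ i, (⟨initialWord m (Shift^[i] z), _, hS.shift_iterate_mem hzS i, rfl⟩ :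
      Words S m) = y i := by
    intro i
    refine Subtype.ext (funext fun j => ?_)
    rw [show (y i).1 j = z (i + j) from hyz j j.2 i]
    change Shift^[i] z j = _
    rw [shift_iterate_apply, add_comm]
  have hyx : ∀ i ∈ Finset.range n, y i = x i := fun i hi => by
    simp only [hy, Nat.mod_eq_of_lt (Finset.mem_range.1 hi)]
  refine ⟨z, hzS, ?_, ?_, ?_⟩
  · funext i
    rw [shift_iterate_apply]
    simp [hz, hy]
  · rw [← hF]
    push_cast
    refine Finset.sum_congr rfl fun i hi => ?_
    rw [hf _ (hS.shift_iterate_mem hzS i), hword, hyx i hi]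
  · rw [← hG]
    refine Finset.sum_congr rfl fun i hi => ?_
    rw [hg _ (hS.shift_iterate_mem hzS i), hword, hyx i hi]

/-- If every closed walk has nonpositive weight, so has every invariant measure. -/
theorem integral_nonpos_of_closed_walks (hS : IsSubshiftFT S) (htrans : TransitiveSubshift S)
    (hf : ∀ x (hx : x ∈ S), f x = F ⟨initialWord m x, x, hx, rfl⟩)
    (hg : ∀ x (hx : x ∈ S), g x = G ⟨initialWord m x, x, hx, rfl⟩) (α β : ℝ)
    (hclosed : ∀ v n a t, WeightedWalk (WordStep S m) F G v v n a t → α * a + β * t ≤ 0)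
    {μ : ProbabilityMeasure (ℕ → Fin N)} (hμ : μ ∈ MS S)
    (hfi : Integrable f (μ : Measure (ℕ → Fin N)))
    (hgi : Integrable g (μ : Measure (ℕ → Fin N))) :
    α * ∫ x, f x ∂(μ : Measure (ℕ → Fin N)) + β * ∫ x, g x ∂(μ : Measure (ℕ → Fin N)) ≤ 0 := by
  obtain ⟨K, hK⟩ := WeightedWalk.exists_bound (htrans.exists_walk hS) α β hclosed
  have h := integral_nonpos_of_birkhoff_le hS hμ
    (ψ := fun x => α * f x + β * g x) ((hfi.const_mul α).add (hgi.const_mul β)) (K := K) ?_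
  · rwa [integral_add (hfi.const_mul α) (hgi.const_mul β), integral_const_mul,
      integral_const_mul] at h
  · intro n x hx
    obtain ⟨a, ha, W⟩ := exists_walk_of_mem hS hx n hf hg
    have h1 := hK _ _ _ _ _ W
    rw [ha] at h1
    refine le_of_eq_of_le ?_ h1
    simp only [birkhoff, Finset.sum_add_distrib, Finset.mul_sum]

/-- If `f` takes both positive and negative averages and the average of `g` is nonpositive
along each periodic orbit on which `f` has zero average, then the same holds for all invariant
measures. -/
theorem integral_nonpos_of_periodic (hS : IsSubshiftFT S) (htrans : TransitiveSubshift S)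
    (hm : 0 < m)
    (hf : ∀ x (hx : x ∈ S), f x = F ⟨initialWord m x, x, hx, rfl⟩)
    (hg : ∀ x (hx : x ∈ S), g x = G ⟨initialWord m x, x, hx, rfl⟩)
    (hfi : ∀ μ ∈ MS S, Integrable f (μ : Measure (ℕ → Fin N)))
    (hgi : ∀ μ ∈ MS S, Integrable g (μ : Measure (ℕ → Fin N)))
    (hpos : ∃ μ ∈ MS S, 0 < ∫ x, f x ∂(μ : Measure (ℕ → Fin N)))
    (hneg : ∃ μ ∈ MS S, ∫ x, f x ∂(μ : Measure (ℕ → Fin N)) < 0)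
    (hper : ∀ μ ∈ MS S, IsPeriodicMeasure S μ → ∫ x, f x ∂(μ : Measure (ℕ → Fin N)) = 0 →
      ∫ x, g x ∂(μ : Measure (ℕ → Fin N)) ≤ 0)
    {μ : ProbabilityMeasure (ℕ → Fin N)} (hμ : μ ∈ MS S)
    (hμf : ∫ x, f x ∂(μ : Measure (ℕ → Fin N)) = 0) :
    ∫ x, g x ∂(μ : Measure (ℕ → Fin N)) ≤ 0 := by
  suffices hex : ∃ c : ℝ, ∀ v n a t, WeightedWalk (WordStep S m) F G v v n a t → t ≤ c * a by
    obtain ⟨c, hc⟩ := hex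
    have h := integral_nonpos_of_closed_walks hS htrans hf hg (-c) 1
      (fun v n a t p => by linarith [hc v n a t p]) hμ (hfi μ hμ) (hgi μ hμ)
    rw [hμf] at h
    linarith
  refine WeightedWalk.exists_multiplier (htrans.exists_walk hS) ?_ ?_ ?_
  · intro v n t p
    rcases Nat.eq_zero_or_pos n with rfl | hn
    · exact p.eq_zero_of_length_eq_zero.2.le
    · obtain ⟨z, hz, hzn, h1, h2⟩ := p.exists_periodic hS hm hf hg hn
      obtain ⟨ν, hν, hνp, hνi⟩ := exists_periodicMeasure hS hz hn hzn
      have h := hper ν hν hνp (by rw [hνi, h1]; simp)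
      rw [hνi, h2, div_le_iff₀ (by exact_mod_cast hn)] at h
      simpa using h
  · by_contra! hcon
    obtain ⟨ν, hν, hlt⟩ := hpos
    have h := integral_nonpos_of_closed_walks hS htrans hf hg 1 0 (fun v n a t p => by
      have ha : (a : ℝ) ≤ 0 := by
        exact_mod_cast not_lt.1 fun ha => hcon v n a t ha p
      linarith) hν (hfi ν hν) (hgi ν hν)
    linarith
  · by_contra! hcon
    obtain ⟨ν, hν, hlt⟩ := hneg
    have h := integral_nonpos_of_closed_walks hS htrans hf hg (-1) 0 (fun v n a t p => by
      have ha : (0 : ℝ) ≤ a := by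
        exact_mod_cast not_lt.1 fun ha => hcon v n a t ha p
      linarith) hν (hfi ν hν) (hgi ν hν)
    linarith

theorem sdist_le_pow {lam : ℝ} (hlam0 : 0 < lam) (hlam1 : lam < 1) {x y : ℕ → Fin N}
    (h : ∀ i < m, x i = y i) : sdist lam x y ≤ lam ^ m := by
  unfold sdist
  split_ifs with hxy
  · positivity
  · refine pow_le_pow_of_le_one hlam0.le hlam1.le (le_csInf ?_ ?_)
    · exact Function.ne_iff.1 hxy
    · intro j hj
      by_contra! hlt
      exact hj (h j hlt)

theorem IsWalters.exists_modulus {lam : ℝ} (hlam0 : 0 < lam) (hlam1 : lam < 1)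
    {A : (ℕ → Fin N) → ℝ} (hA : IsWalters S lam A) {ε : ℝ} (hε : 0 < ε) :
    ∃ m, ∀ x ∈ S, ∀ y ∈ S, (∀ i < m, x i = y i) → |A x - A y| ≤ ε := by
  obtain ⟨H, -, -, hH, hW⟩ := hA
  have h1 : ∀ᶠ m : ℕ in atTop, H (lam ^ m) < ENNReal.ofReal ε :=
    (hH.comp (tendsto_pow_atTop_nhdsWithin_zero_of_lt_one hlam0 hlam1)).eventually_lt_const
      (ENNReal.ofReal_pos.2 hε)
  obtain ⟨m, hm⟩ := h1.exists
  refine ⟨m, fun x hx y hy hxy => ?_⟩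
  have h := hW (lam ^ m) (by positivity) 1 one_pos x hx y hy (fun j hj => by
    obtain rfl : j = 0 := by omega
    exact sdist_le_pow hlam0 hlam1 hxy)
  simp only [birkhoff, Finset.sum_range_one, Function.iterate_zero, id] at h
  exact (ENNReal.ofReal_le_ofReal_iff hε.le).1 (h.trans hm.le)

/-- The function of the initial word obtained by choosing a point in each cylinder. -/
noncomputable def cylinderValue (S : Set (ℕ → Fin N)) (m : ℕ) (A : (ℕ → Fin N) → ℝ)
    (v : Words S m) : ℝ := A v.2.choose

open Classical in
/-- The locally constant approximation of `A` on cylinders of length `m`. -/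
noncomputable def cylinderApprox (S : Set (ℕ → Fin N)) (m : ℕ) (A : (ℕ → Fin N) → ℝ)
    (x : ℕ → Fin N) : ℝ :=
  if h : ∃ y ∈ S, initialWord m y = initialWord m x then
    cylinderValue S m A ⟨initialWord m x, h⟩ else 0

theorem cylinderApprox_of_mem {A : (ℕ → Fin N) → ℝ} {x : ℕ → Fin N} (hx : x ∈ S) :
    cylinderApprox S m A x = cylinderValue S m A ⟨initialWord m x, x, hx, rfl⟩ :=
  dif_pos ⟨x, hx, rfl⟩

theorem cylinderValue_spec {A : (ℕ → Fin N) → ℝ} {x : ℕ → Fin N} (hx : x ∈ S) {ε : ℝ}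
    (h : ∀ x ∈ S, ∀ y ∈ S, (∀ i < m, x i = y i) → |A x - A y| ≤ ε) :
    |A x - cylinderValue S m A ⟨initialWord m x, x, hx, rfl⟩| ≤ ε := by
  have hex : ∃ y ∈ S, initialWord m y = initialWord m x := ⟨x, hx, rfl⟩
  refine h x hx _ hex.choose_spec.1 fun i hi => ?_
  exact (congrFun hex.choose_spec.2 ⟨i, hi⟩).symm

theorem measurable_cylinderApprox (A : (ℕ → Fin N) → ℝ) :
    Measurable (cylinderApprox S m A) := by
  classical
  have h : cylinderApprox S m A = (fun v : Fin m → Fin N =>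
      if h : ∃ y ∈ S, initialWord m y = v then cylinderValue S m A ⟨v, h⟩ else 0) ∘
        initialWord m := rfl
  rw [h]
  exact (measurable_of_finite _).comp (measurable_pi_lambda _ fun i => measurable_pi_apply _)

/-- A function with uniformly small oscillation on cylinders is bounded on `S`. -/
theorem exists_bound_of_modulus {A : (ℕ → Fin N) → ℝ} {ε : ℝ}
    (h : ∀ x ∈ S, ∀ y ∈ S, (∀ i < m, x i = y i) → |A x - A y| ≤ ε) :
    ∃ C, ∀ x ∈ S, |A x| ≤ C := by
  obtain ⟨C, hC⟩ := (Set.finite_range fun v : Words S m => |cylinderValue S m A v|).bddAbove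
  refine ⟨C + ε, fun x hx => ?_⟩
  have h1 := cylinderValue_spec hx h
  have h2 : |cylinderValue S m A ⟨initialWord m x, x, hx, rfl⟩| ≤ C := hC ⟨_, rfl⟩
  have h3 := abs_add_le (A x - cylinderValue S m A ⟨initialWord m x, x, hx, rfl⟩)
    (cylinderValue S m A ⟨initialWord m x, x, hx, rfl⟩)
  rw [sub_add_cancel] at h3
  linarith

theorem integrable_of_bound_on (hS : IsSubshiftFT S) {A : (ℕ → Fin N) → ℝ} (hA : Measurable A)
    {C : ℝ} (hC : ∀ x ∈ S, |A x| ≤ C) {μ : ProbabilityMeasure (ℕ → Fin N)} (hμ : μ ∈ MS S) :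
    Integrable A (μ : Measure (ℕ → Fin N)) :=
  Integrable.of_bound hA.aestronglyMeasurable C
    ((ae_mem_of_mem_MS hS hμ).mono fun x hx => hC x hx)

theorem exists_common_denominator {ι : Type*} [Finite ι] (q : ι → ℝ)
    (hq : ∀ i, ∃ a : ℚ, q i = a) : ∃ D : ℝ, 0 < D ∧ ∀ i, ∃ k : ℤ, D * q i = k := by
  choose a ha using hq
  have := Fintype.ofFinite ι
  refine ⟨((∏ i, (a i).den : ℕ) : ℝ), by
    exact_mod_cast Finset.prod_pos fun i _ => (a i).pos, fun i => ?_⟩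
  obtain ⟨c, hc⟩ : (a i).den ∣ ∏ i, (a i).den := Finset.dvd_prod_of_mem _ (Finset.mem_univ i)
  refine ⟨c * (a i).num, ?_⟩
  have h := Rat.den_mul_eq_num (a i)
  have h' : ((a i).den : ℝ) * (a i : ℝ) = (a i).num := by exact_mod_cast h
  rw [ha, hc]
  push_cast
  rw [← h']
  ring

end Dynamics

/-- A bound for the integrals of `A` against the periodic measures in the fiber over `r` holds
for all invariant measures in the fiber. -/
theorem integral_le_of_periodic_le {N : ℕ} {S : Set (ℕ → Fin N)} (hS : IsSubshiftFT S)
    (htrans : TransitiveSubshift S)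
    {lam : ℝ} (hlam0 : 0 < lam) (hlam1 : lam < 1)
    {φ : (ℕ → Fin N) → ℝ} (hφm : Measurable φ)
    (hφlc : LocallyConstantFn φ) (hφQ : ∀ x, ∃ q : ℚ, φ x = (q : ℝ))
    {A : (ℕ → Fin N) → ℝ} (hAm : Measurable A) (hA : IsWalters S lam A)
    {r : ℝ} (hrQ : ∃ q : ℚ, r = (q : ℝ)) (hr : r ∈ interior (rotSet1 S φ)) {s : ℝ}
    (hper : ∀ μ ∈ MS S, IsPeriodicMeasure S μ → ∫ x, φ x ∂(μ : Measure (ℕ → Fin N)) = r →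
      ∫ x, A x ∂(μ : Measure (ℕ → Fin N)) ≤ s)
    {μ : ProbabilityMeasure (ℕ → Fin N)} (hμ : μ ∈ MS S)
    (hμr : ∫ x, φ x ∂(μ : Measure (ℕ → Fin N)) = r) :
    ∫ x, A x ∂(μ : Measure (ℕ → Fin N)) ≤ s := by
  refine le_of_forall_pos_le_add fun ε hε => ?_
  obtain ⟨m₁, hm₁⟩ := hA.exists_modulus hlam0 hlam1 (half_pos hε)
  obtain ⟨j, hj⟩ := hφlc
  obtain ⟨m, hm⟩ : ∃ m, m = max m₁ (j + 1) := ⟨_, rfl⟩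
  have hm0 : 0 < m := by omega
  have hAmod : ∀ x ∈ S, ∀ y ∈ S, (∀ i < m, x i = y i) → |A x - A y| ≤ ε / 2 :=
    fun x hx y hy h => hm₁ x hx y hy fun i hi => h i (by omega)
  have hφmod : ∀ x ∈ S, ∀ y ∈ S, (∀ i < m, x i = y i) → |φ x - φ y| ≤ 0 :=
    fun x _ y _ h => by simp [hj x y fun i hi => h i (by omega)]
  obtain ⟨CA, hCA⟩ := exists_bound_of_modulus hAmod
  obtain ⟨Cφ, hCφ⟩ := exists_bound_of_modulus hφmod
  have hAi : ∀ μ ∈ MS S, Integrable A (μ : Measure (ℕ → Fin N)) :=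
    fun μ hμ => integrable_of_bound_on hS hAm hCA hμ
  have hφi : ∀ μ ∈ MS S, Integrable φ (μ : Measure (ℕ → Fin N)) :=
    fun μ hμ => integrable_of_bound_on hS hφm hCφ hμ
  have hclose : ∀ x ∈ S, |A x - cylinderApprox S m A x| ≤ ε / 2 := fun x hx => by
    rw [cylinderApprox_of_mem hx]
    exact cylinderValue_spec hx hAmod
  have hBi : ∀ μ ∈ MS S, Integrable (cylinderApprox S m A) (μ : Measure (ℕ → Fin N)) :=
    fun μ hμ => integrable_of_bound_on hS (measurable_cylinderApprox A) (C := CA + ε / 2)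
      (fun x hx => by
        have h1 := hclose x hx
        have h2 := hCA x hx
        rw [abs_le] at *
        constructor <;> linarith) hμ
  have hAB : ∀ μ ∈ MS S, ∫ x, cylinderApprox S m A x ∂(μ : Measure (ℕ → Fin N)) ≤
      ∫ x, A x ∂(μ : Measure (ℕ → Fin N)) + ε / 2 ∧ ∫ x, A x ∂(μ : Measure (ℕ → Fin N)) ≤
      ∫ x, cylinderApprox S m A x ∂(μ : Measure (ℕ → Fin N)) + ε / 2 := by
    intro μ hμ
    have hbd : ∀ᵐ x ∂(μ : Measure (ℕ → Fin N)), ‖A x - cylinderApprox S m A x‖ ≤ ε / 2 :=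
      (ae_mem_of_mem_MS hS hμ).mono fun x hx => hclose x hx
    have h := norm_integral_le_of_norm_le_const hbd
    rw [integral_sub (hAi μ hμ) (hBi μ hμ), Real.norm_eq_abs, abs_le] at h
    simp only [probReal_univ, mul_one] at h
    constructor <;> linarith [h.1, h.2]
  obtain ⟨q, hq⟩ := hrQ
  obtain ⟨D, hD, hDk⟩ := exists_common_denominator
    (fun v : Words S m => cylinderValue S m φ v - r) fun v => by
      obtain ⟨p, hp⟩ := hφQ v.2.choose
      exact ⟨p - q, by simp [cylinderValue, hp, hq]⟩
  choose F hF using hDk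
  have hint : ∀ μ ∈ MS S, ∫ x, D * (φ x - r) ∂(μ : Measure (ℕ → Fin N)) =
      D * (∫ x, φ x ∂(μ : Measure (ℕ → Fin N)) - r) := by
    intro μ hμ
    rw [integral_const_mul, integral_sub (hφi μ hμ) (integrable_const _)]
    simp
  have hintB : ∀ μ ∈ MS S,
      ∫ x, (cylinderApprox S m A x - (s + ε / 2)) ∂(μ : Measure (ℕ → Fin N)) =
      ∫ x, cylinderApprox S m A x ∂(μ : Measure (ℕ → Fin N)) - (s + ε / 2) := by
    intro μ hμ
    rw [integral_sub (hBi μ hμ) (integrable_const _)]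
    simp
  obtain ⟨δ, hδ, hball⟩ := Metric.mem_nhds_iff.1 (mem_interior_iff_mem_nhds.1 hr)
  have main := integral_nonpos_of_periodic (F := F)
    (G := fun v => cylinderValue S m A v - (s + ε / 2)) (f := fun x => D * (φ x - r))
    (g := fun x => cylinderApprox S m A x - (s + ε / 2)) hS htrans hm0
    (fun x hx => by
      rw [← hF]
      have h := cylinderValue_spec hx hφmod
      rw [sub_eq_zero.1 (abs_nonpos_iff.1 h)])
    (fun x hx => by rw [cylinderApprox_of_mem hx])
    (fun μ hμ => ((hφi μ hμ).sub (integrable_const r)).const_mul D)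
    (fun μ hμ => (hBi μ hμ).sub (integrable_const _))
    (by
      obtain ⟨ν, hν, h⟩ := hball (show r + δ / 2 ∈ Metric.ball r δ by
        simp [abs_of_pos hδ, hδ])
      exact ⟨ν, hν, by rw [hint ν hν, h]; simp; positivity⟩)
    (by
      obtain ⟨ν, hν, h⟩ := hball (show r - δ / 2 ∈ Metric.ball r δ by
        simp [abs_of_pos hδ, hδ])
      exact ⟨ν, hν, by rw [hint ν hν, h]; nlinarith⟩)
    (fun ν hν hνp h0 => by
      rw [hint ν hν] at h0
      have h1 := (mul_eq_zero.1 h0).resolve_left hD.ne'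
      have h2 := hper ν hν hνp (sub_eq_zero.1 h1)
      rw [hintB ν hν]
      linarith [(hAB ν hν).1])
    hμ (by rw [hint μ hμ, hμr]; simp)
  rw [hintB μ hμ] at main
  linarith [(hAB μ hμ).2]

/-- on a transitive subshift of finite type, if `φ` is a rational-valued
locally constant constraint and `A` a Walters potential, then for every rational `r` in the
interior of the rotation set `φ_*(M_σ)`, `β_{A,φ}(r)` equals the supremum of `∫A dμ` over
periodic probability measures `μ` in the fiber `φ_*^{-1}(r)`. -/
theorem stmt16 {N : ℕ} (S : Set (ℕ → Fin N)) (hS : IsSubshiftFT S)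
    (htrans : TransitiveSubshift S)
    (lam : ℝ) (hlam0 : 0 < lam) (hlam1 : lam < 1)
    (φ : (ℕ → Fin N) → ℝ) (hφm : Measurable φ)
    (hφlc : LocallyConstantFn φ) (hφQ : ∀ x, ∃ q : ℚ, φ x = (q : ℝ))
    (A : (ℕ → Fin N) → ℝ) (hAm : Measurable A) (hA : IsWalters S lam A)
    (r : ℝ) (hrQ : ∃ q : ℚ, r = (q : ℝ)) (hr : r ∈ interior (rotSet1 S φ)) :
    betaS1 S A φ r = sSup {t : ℝ | ∃ μ ∈ MS S, IsPeriodicMeasure S μ ∧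
      ∫ x, φ x ∂(μ : Measure (ℕ → Fin N)) = r ∧
      ∫ x, A x ∂(μ : Measure (ℕ → Fin N)) = t} := by
  have hPT : {t : ℝ | ∃ μ ∈ MS S, IsPeriodicMeasure S μ ∧
      ∫ x, φ x ∂(μ : Measure (ℕ → Fin N)) = r ∧
      ∫ x, A x ∂(μ : Measure (ℕ → Fin N)) = t} ⊆
      {t : ℝ | ∃ μ ∈ MS S, ∫ x, φ x ∂(μ : Measure (ℕ → Fin N)) = r ∧
        ∫ x, A x ∂(μ : Measure (ℕ → Fin N)) = t} :=
    fun t ⟨μ, hμ, _, h⟩ => ⟨μ, hμ, h⟩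
  obtain ⟨μ₀, hμ₀, hμ₀r⟩ := interior_subset hr
  have hbdd : BddAbove {t : ℝ | ∃ μ ∈ MS S, ∫ x, φ x ∂(μ : Measure (ℕ → Fin N)) = r ∧
      ∫ x, A x ∂(μ : Measure (ℕ → Fin N)) = t} := by
    obtain ⟨m, hm⟩ := hA.exists_modulus hlam0 hlam1 one_pos
    obtain ⟨C, hC⟩ := exists_bound_of_modulus hm
    refine ⟨C, ?_⟩
    rintro _ ⟨μ, hμ, -, rfl⟩
    have h := integral_mono_ae (integrable_of_bound_on hS hAm hC hμ) (integrable_const C)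
      ((ae_mem_of_mem_MS hS hμ).mono fun x hx => (abs_le.1 (hC x hx)).2)
    simpa using h
  refine le_antisymm (csSup_le ⟨_, μ₀, hμ₀, hμ₀r, rfl⟩ ?_) (csSup_le_csSup hbdd ?_ hPT)
  · rintro _ ⟨μ, hμ, hμr, rfl⟩
    exact integral_le_of_periodic_le hS htrans hlam0 hlam1 hφm hφlc hφQ hAm hA hrQ hr
      (fun ν hν hνp h => le_csSup (hbdd.mono hPT) ⟨ν, hν, hνp, h, rfl⟩) hμ hμr
  · by_contra hempty
    have h := integral_le_of_periodic_le hS htrans hlam0 hlam1 hφm hφlc hφQ hAm hA hrQ hr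
      (s := ∫ x, A x ∂(μ₀ : Measure (ℕ → Fin N)) - 1)
      (fun ν hν hνp h => absurd ⟨_, ν, hν, hνp, h, rfl⟩ hempty) hμ₀ hμ₀r
    linarith
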